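/- (Proposition 1, pullback formula.) Let w : ℝ → ℝ³ and R : ℝ → M₃(ℝ) be differentiable with R(r)^T R(r) = I and det R(r) = 1 for all r. For r > 0 and unit vectors θ ∈ ℝ³ define b = √(1+‖w(r)‖²), W = I + ww^T/(b+1), W^{-1} = I − ww^T/(b(b+1)), f = b + θ^T w, ρ(r,θ) = r f, ζ(r,θ) = f^{-1} R(w + Wθ), S₁ = W R^{-1} R' W, s₁ = *S₁ + (b+1)^{-1} w' × w, t₁ = b^{-1} S₁ w + W^{-1} w', and β(r,θ) = r(t₁ − (θ^T t₁)θ) + r θ × s₁. Then for every r > 0, every unit θ, every v ∈ ℝ³ with θ^T v = 0, and every a ∈ ℝ: ρ(r,θ)² · ‖ D_θζ(v) + a·∂ζ/∂r ‖² = ‖ r v + a β(r,θ) ‖², where D_θζ(v) denotes the Fréchet derivative of θ ↦ ζ(r,θ) at θ applied to v, and ∂ζ/∂r the derivative in r. (Equivalently, the pullback of the degenerate cone metric ρ²|dζ|² equals |r dθ + β dr|².) -/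

import Mathlib

open Matrix

/-- `b = √(1+‖w‖²)`. -/
noncomputable def bOf (w : Fin 3 → ℝ) : ℝ := Real.sqrt (1 + w ⬝ᵥ w)

/-- `W = I + w wᵀ/(b+1)`. -/
noncomputable def WOf (w : Fin 3 → ℝ) : Matrix (Fin 3) (Fin 3) ℝ :=
  1 + (bOf w + 1)⁻¹ • vecMulVec w w

/-- `W⁻¹ = I − w wᵀ/(b(b+1))`. -/
noncomputable def WinvOf (w : Fin 3 → ℝ) : Matrix (Fin 3) (Fin 3) ℝ :=
  1 - (bOf w * (bOf w + 1))⁻¹ • vecMulVec w w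

/-- `*S`, with components `(*S)ᵢ = ½ Σ εᵢⱼₖ Sⱼₖ`. -/
noncomputable def starVec (S : Matrix (Fin 3) (Fin 3) ℝ) : Fin 3 → ℝ :=
  ![(S 1 2 - S 2 1) / 2, (S 2 0 - S 0 2) / 2, (S 0 1 - S 1 0) / 2]


lemma aux_b_sq (w : Fin 3 → ℝ) : bOf w ^ 2 = 1 + w ⬝ᵥ w := by
  have h : 0 ≤ w ⬝ᵥ w := by
    simp only [dotProduct, Fin.sum_univ_three]; nlinarith [sq_nonneg (w 0), sq_nonneg (w 1), sq_nonneg (w 2)]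
  exact Real.sq_sqrt (by linarith)

lemma aux_b_pos (w : Fin 3 → ℝ) : 0 < bOf w := by
  have h : 0 ≤ w ⬝ᵥ w := by
    simp only [dotProduct, Fin.sum_univ_three]; nlinarith [sq_nonneg (w 0), sq_nonneg (w 1), sq_nonneg (w 2)]
  exact Real.sqrt_pos.2 (by linarith)

lemma aux_f_pos (w θ : Fin 3 → ℝ) (hθ : θ ⬝ᵥ θ = 1) : 0 < bOf w + θ ⬝ᵥ w := by
  have h1 := aux_b_sq w
  have h2 := aux_b_pos w
  have h3 : (θ ⬝ᵥ w) ^ 2 ≤ (θ ⬝ᵥ θ) * (w ⬝ᵥ w) := by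
    simp only [dotProduct, Fin.sum_univ_three]
    nlinarith [sq_nonneg (θ 0 * w 1 - θ 1 * w 0), sq_nonneg (θ 0 * w 2 - θ 2 * w 0),
      sq_nonneg (θ 1 * w 2 - θ 2 * w 1)]
  rw [hθ] at h3
  nlinarith

lemma aux_W (w z : Fin 3 → ℝ) :
    WOf w *ᵥ z = z + ((bOf w + 1)⁻¹ * (w ⬝ᵥ z)) • w := by
  ext i
  fin_cases i <;>
  simp [WOf, Matrix.add_mulVec, Matrix.smul_mulVec, mulVec, vecMulVec, dotProduct, Fin.sum_univ_three] <;> ring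

lemma aux_Winv (w z : Fin 3 → ℝ) :
    WinvOf w *ᵥ z = z - ((bOf w * (bOf w + 1))⁻¹ * (w ⬝ᵥ z)) • w := by
  ext i
  fin_cases i <;>
  simp [WinvOf, Matrix.sub_mulVec, Matrix.smul_mulVec, mulVec, vecMulVec, dotProduct, Fin.sum_univ_three] <;> ring

lemma aux_WT (w : Fin 3 → ℝ) : (WOf w)ᵀ = WOf w := by
  ext i j
  simp [WOf, vecMulVec, Matrix.one_apply, eq_comm, mul_comm]

lemma aux_star (S : Matrix (Fin 3) (Fin 3) ℝ) (hS : Sᵀ = -S) (θ : Fin 3 → ℝ) :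
    crossProduct θ (starVec S) = S *ᵥ θ := by
  have h : ∀ i j, S j i = - S i j := fun i j => by
    have := congrFun (congrFun hS i) j
    simpa using this
  have h0 := h 0 0
  have h1 := h 1 1
  have h2 := h 2 2
  have h3 := h 0 1
  have h4 := h 0 2
  have h5 := h 1 2
  have h0 : S 0 0 = 0 := by linarith
  have h1 : S 1 1 = 0 := by linarith
  have h2 : S 2 2 = 0 := by linarith
  ext i
  fin_cases i <;>
  simp [starVec, crossProduct, mulVec, dotProduct, Fin.sum_univ_three, h0, h1, h2, h3, h4, h5] <;> ring

lemma aux_antisymm_quad (S : Matrix (Fin 3) (Fin 3) ℝ) (hS : Sᵀ = -S) (θ : Fin 3 → ℝ) :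
    θ ⬝ᵥ (S *ᵥ θ) = 0 := by
  have h : θ ⬝ᵥ (S *ᵥ θ) = - (θ ⬝ᵥ (S *ᵥ θ)) := by
    conv_lhs => rw [dotProduct_mulVec, ← mulVec_transpose, hS, dotProduct_comm]
    simp [neg_mulVec]
  linarith

lemma aux_cross (a b c : Fin 3 → ℝ) :
    crossProduct a (crossProduct b c) = (a ⬝ᵥ c) • b - (a ⬝ᵥ b) • c := by
  ext i
  fin_cases i <;>
  simp [crossProduct, dotProduct, Fin.sum_univ_three] <;> ring

lemma aux_deriv (g : ℝ → ℝ) (g' : ℝ) (u : ℝ → Fin 3 → ℝ) (u' : Fin 3 → ℝ)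
    (R : ℝ → Matrix (Fin 3) (Fin 3) ℝ) (R' : Matrix (Fin 3) (Fin 3) ℝ) (r : ℝ)
    (hg : HasDerivAt g g' r) (hu : HasDerivAt u u' r)
    (hR : ∀ i j, HasDerivAt (fun s => R s i j) (R' i j) r) (h0 : g r ≠ 0) :
    HasDerivAt (fun s => (g s)⁻¹ • (R s *ᵥ u s))
      ((-g' / g r ^ 2) • (R r *ᵥ u r) + (g r)⁻¹ • (R' *ᵥ u r + R r *ᵥ u')) r := by
  rw [hasDerivAt_pi] at hu ⊢
  intro i
  have h := (hg.inv h0).mul ((((hR i 0).mul (hu 0)).add ((hR i 1).mul (hu 1))).add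
    ((hR i 2).mul (hu 2)))
  refine (h.congr_deriv ?_).congr_of_eventuallyEq (Filter.Eventually.of_forall fun s => ?_)
  · simp [mulVec, dotProduct, Fin.sum_univ_three]; ring
  · simp [mulVec, dotProduct, Fin.sum_univ_three]

lemma aux_dot_deriv (u v : ℝ → Fin 3 → ℝ) (u' v' : Fin 3 → ℝ) (r : ℝ)
    (hu : HasDerivAt u u' r) (hv : HasDerivAt v v' r) :
    HasDerivAt (fun s => u s ⬝ᵥ v s) (u' ⬝ᵥ v r + u r ⬝ᵥ v') r := by
  rw [hasDerivAt_pi] at hu hv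
  have h := (((hu 0).mul (hv 0)).add ((hu 1).mul (hv 1))).add ((hu 2).mul (hv 2))
  refine (h.congr_deriv ?_).congr_of_eventuallyEq (Filter.Eventually.of_forall fun s => ?_)
  · simp [dotProduct, Fin.sum_univ_three]; ring
  · simp [dotProduct, Fin.sum_univ_three]

lemma aux_b_deriv (w : ℝ → Fin 3 → ℝ) (w' : Fin 3 → ℝ) (r : ℝ) (hw : HasDerivAt w w' r) :
    HasDerivAt (fun s => bOf (w s)) ((w r ⬝ᵥ w') / bOf (w r)) r := by
  have hb := aux_b_pos (w r)
  have hb2 := aux_b_sq (w r)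
  have h := ((aux_dot_deriv w w w' w' r hw hw).const_add 1).sqrt (by nlinarith)
  refine h.congr_deriv ?_
  change _ / (2 * bOf (w r)) = _
  rw [dotProduct_comm w']
  field_simp
  ring

lemma aux_fderiv (b : ℝ) (w θ v : Fin 3 → ℝ) (M W : Matrix (Fin 3) (Fin 3) ℝ)
    (h0 : b + θ ⬝ᵥ w ≠ 0) :
    fderiv ℝ (fun x : Fin 3 → ℝ => (b + x ⬝ᵥ w)⁻¹ • (M *ᵥ (w + W *ᵥ x))) θ v =
      (-(v ⬝ᵥ w) / (b + θ ⬝ᵥ w) ^ 2) • (M *ᵥ (w + W *ᵥ θ))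
        + (b + θ ⬝ᵥ w)⁻¹ • (M *ᵥ (W *ᵥ v)) := by
  have hd : DifferentiableAt ℝ (fun x : Fin 3 → ℝ => (b + x ⬝ᵥ w)⁻¹ • (M *ᵥ (w + W *ᵥ x))) θ := by
    have h1 : DifferentiableAt ℝ (fun x : Fin 3 → ℝ => b + x ⬝ᵥ w) θ := by
      simp only [dotProduct]; fun_prop
    have h2 : DifferentiableAt ℝ (fun x : Fin 3 → ℝ => M *ᵥ (w + W *ᵥ x)) θ := by
      rw [differentiableAt_pi]
      intro i
      simp only [mulVec, dotProduct, Pi.add_apply]; fun_prop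
    exact (h1.inv h0).smul h2
  have hl : HasDerivAt (fun t : ℝ => θ + t • v) v 0 := by
    simpa using ((hasDerivAt_id (0 : ℝ)).smul_const v).const_add θ
  have hc : HasDerivAt (fun t : ℝ => (b + (θ + t • v) ⬝ᵥ w)⁻¹ • (M *ᵥ (w + W *ᵥ (θ + t • v))))
      (fderiv ℝ (fun x : Fin 3 → ℝ => (b + x ⬝ᵥ w)⁻¹ • (M *ᵥ (w + W *ᵥ x))) θ v) 0 := by
    have := HasFDerivAt.comp_hasDerivAt (f := fun t : ℝ => θ + t • v) (0 : ℝ)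
      (l := fun x : Fin 3 → ℝ => (b + x ⬝ᵥ w)⁻¹ • (M *ᵥ (w + W *ᵥ x)))
      (l' := fderiv ℝ (fun x : Fin 3 → ℝ => (b + x ⬝ᵥ w)⁻¹ • (M *ᵥ (w + W *ᵥ x))) θ)
      (by simpa using hd.hasFDerivAt) hl
    exact this
  have hg : HasDerivAt (fun t : ℝ => b + (θ + t • v) ⬝ᵥ w) (v ⬝ᵥ w) 0 := by
    simpa using (aux_dot_deriv _ _ _ _ 0 hl (hasDerivAt_const 0 w)).const_add b
  have hu : HasDerivAt (fun t : ℝ => w + W *ᵥ (θ + t • v)) (W *ᵥ v) 0 := by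
    simp only [mulVec_add, mulVec_smul]
    simpa using (((hasDerivAt_id (0 : ℝ)).smul_const (W *ᵥ v)).const_add (W *ᵥ θ)).const_add w
  have h := aux_deriv _ _ _ _ (fun _ => M) 0 0 hg hu
    (fun i j => by simpa using hasDerivAt_const (0 : ℝ) (M i j)) (by simpa using h0)
  have := hc.unique h
  rw [this]
  simp

/-- derivative of `w + W θ` in `r` -/
lemma aux_m_deriv (w : ℝ → Fin 3 → ℝ) (w' θ : Fin 3 → ℝ) (r : ℝ) (hw : HasDerivAt w w' r) :
    HasDerivAt (fun s => w s + WOf (w s) *ᵥ θ)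
      (w' + (((bOf (w r) + 1)⁻¹ * (w r ⬝ᵥ θ)) • w' +
        (-((w r ⬝ᵥ w') / bOf (w r)) / (bOf (w r) + 1) ^ 2 * (w r ⬝ᵥ θ)
          + (bOf (w r) + 1)⁻¹ * (w' ⬝ᵥ θ)) • w r)) r := by
  have hb := aux_b_pos (w r)
  simp only [aux_W]
  have h1 := ((aux_b_deriv w w' r hw).add_const 1).inv (by positivity)
  have h2 := aux_dot_deriv w _ _ _ r hw (hasDerivAt_const r θ)
  have h3 := hw.add (((h1.mul h2).smul hw).const_add θ)
  refine h3.congr_deriv ?_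
  simp

lemma aux_norm (b : ℝ) (w θ z : Fin 3 → ℝ) (hb : 0 < b) (hb2 : b ^ 2 = 1 + w ⬝ᵥ w)
    (hθ : θ ⬝ᵥ θ = 1) (hz : θ ⬝ᵥ z = 0) (hf : b + θ ⬝ᵥ w ≠ 0) (Y : Fin 3 → ℝ)
    (hY : Y = z + ((b + 1)⁻¹ * (w ⬝ᵥ z)) • w
      - ((b + θ ⬝ᵥ w)⁻¹ * (w ⬝ᵥ z)) • (w + (θ + ((b + 1)⁻¹ * (w ⬝ᵥ θ)) • w))) :
    Y ⬝ᵥ Y = z ⬝ᵥ z := by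
  have hb1 : b + 1 ≠ 0 := by positivity
  have hww : w ⬝ᵥ w = b ^ 2 - 1 := by linarith
  rw [hY]
  simp only [dotProduct_add, add_dotProduct, dotProduct_sub, sub_dotProduct, dotProduct_smul,
    smul_dotProduct, smul_eq_mul, dotProduct_comm z w, dotProduct_comm z θ, dotProduct_comm w θ,
    hww, hθ, hz]
  generalize θ ⬝ᵥ w = q at *
  generalize w ⬝ᵥ z = p at *
  field_simp
  ring

lemma aux_core (b a : ℝ) (w w' θ v u z : Fin 3 → ℝ) (hb : 0 < b) (hb2 : b ^ 2 = 1 + w ⬝ᵥ w)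
    (hf : b + θ ⬝ᵥ w ≠ 0) 
    (hz : z = v + a • (u + ((b + 1)⁻¹ * (w ⬝ᵥ u)) • w + (w ⬝ᵥ u) • θ
      + (w' - ((b * (b + 1))⁻¹ * (w ⬝ᵥ w')) • w)
      - (θ ⬝ᵥ (w' - ((b * (b + 1))⁻¹ * (w ⬝ᵥ w')) • w)) • θ
      + (b + 1)⁻¹ • ((θ ⬝ᵥ w) • w' - (θ ⬝ᵥ w') • w))) :
    z + ((b + 1)⁻¹ * (w ⬝ᵥ z)) • w
      - ((b + θ ⬝ᵥ w)⁻¹ * (w ⬝ᵥ z)) • (w + (θ + ((b + 1)⁻¹ * (w ⬝ᵥ θ)) • w))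
    = (-(v ⬝ᵥ w + a * (w ⬝ᵥ w' / b + θ ⬝ᵥ w')) / (b + θ ⬝ᵥ w)) •
        (w + (θ + ((b + 1)⁻¹ * (w ⬝ᵥ θ)) • w))
      + (v + ((b + 1)⁻¹ * (w ⬝ᵥ v)) • w) + a • u
      + a • (w' + (((b + 1)⁻¹ * (w ⬝ᵥ θ)) • w' +
        (-((w ⬝ᵥ w') / b) / (b + 1) ^ 2 * (w ⬝ᵥ θ)
          + (b + 1)⁻¹ * (w' ⬝ᵥ θ)) • w)) := by
  have hb1 : b + 1 ≠ 0 := by positivity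
  have hww : w ⬝ᵥ w = b ^ 2 - 1 := by linarith
  rw [hz]
  simp only [dotProduct_add, add_dotProduct, dotProduct_sub, sub_dotProduct, dotProduct_smul,
    smul_dotProduct, smul_eq_mul, dotProduct_comm v w, dotProduct_comm w θ, dotProduct_comm w' θ,
    hww]
  ext i
  simp only [Pi.add_apply, Pi.sub_apply, Pi.smul_apply, smul_eq_mul]
  generalize θ ⬝ᵥ w = q at *
  generalize θ ⬝ᵥ w' = k at *
  generalize w ⬝ᵥ w' = p at *
  generalize w ⬝ᵥ u = e at *
  generalize w ⬝ᵥ v = g at *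
  generalize w i = wi at *
  generalize w' i = wi' at *
  generalize u i = ui at *
  generalize v i = vi at *
  generalize θ i = ti at *
  field_simp
  ring

/-- Proposition 1, pullback formula: with
`ρ(r,θ) = r f(θ; w(r))` and `ζ(r,θ) = f⁻¹ R(r)(w(r) + W θ)`, for every `r > 0`,
every unit `θ`, every tangent vector `v` (`θᵀv = 0`) and every `a ∈ ℝ`,
`ρ² ‖D_θζ(v) + a ∂ζ/∂r‖² = ‖r v + a β‖²`,
i.e. the pullback of the degenerate cone metric `ρ²|dζ|²` is `|r dθ + β dr|²`. -/
theorem pullback_cone_metric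
    (w w' : ℝ → Fin 3 → ℝ) (R R' : ℝ → Matrix (Fin 3) (Fin 3) ℝ)
    (hw : ∀ r, HasDerivAt w (w' r) r)
    (hR : ∀ r i j, HasDerivAt (fun s => R s i j) (R' r i j) r)
    (hRorth : ∀ r, (R r)ᵀ * R r = 1) (hRdet : ∀ r, (R r).det = 1) :
    ∀ r : ℝ, 0 < r → ∀ θ : Fin 3 → ℝ, Real.sqrt (θ ⬝ᵥ θ) = 1 →
    ∀ v : Fin 3 → ℝ, θ ⬝ᵥ v = 0 → ∀ a : ℝ,
      let ζ : ℝ → (Fin 3 → ℝ) → (Fin 3 → ℝ) := fun s x =>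
        (bOf (w s) + x ⬝ᵥ w s)⁻¹ • (R s *ᵥ (w s + WOf (w s) *ᵥ x))
      let b : ℝ := bOf (w r)
      let f : ℝ := b + θ ⬝ᵥ w r
      let ρ : ℝ := r * f
      let S₁ : Matrix (Fin 3) (Fin 3) ℝ := WOf (w r) * (R r)⁻¹ * R' r * WOf (w r)
      let s₁ : Fin 3 → ℝ := starVec S₁ + (b + 1)⁻¹ • crossProduct (w' r) (w r)
      let t₁ : Fin 3 → ℝ := b⁻¹ • (S₁ *ᵥ w r) + WinvOf (w r) *ᵥ w' r
      let β : Fin 3 → ℝ := r • (t₁ - (θ ⬝ᵥ t₁) • θ) + r • crossProduct θ s₁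
      let X : Fin 3 → ℝ := fderiv ℝ (fun x => ζ r x) θ v + a • deriv (fun s => ζ s θ) r
      ρ ^ 2 * (X ⬝ᵥ X) = (r • v + a • β) ⬝ᵥ (r • v + a • β) := by
  intro r hr θ hθ' v hv a ζ b f ρ S₁ s₁ t₁ β X
  have hθ : θ ⬝ᵥ θ = 1 := by
    rwa [Real.sqrt_eq_one] at hθ'
  have hb : 0 < b := aux_b_pos (w r)
  have hb2 : b ^ 2 = 1 + w r ⬝ᵥ w r := aux_b_sq (w r)
  have hf : 0 < f := aux_f_pos (w r) θ hθ
  have hinv : (R r)⁻¹ = (R r)ᵀ := Matrix.inv_eq_left_inv (hRorth r)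
  have hRR : R r * (R r)ᵀ = 1 := mul_eq_one_comm.1 (hRorth r)
  obtain ⟨A, hA⟩ : ∃ A, A = (R r)ᵀ * R' r := ⟨_, rfl⟩
  have hR' : R' r = R r * A := by rw [hA, ← Matrix.mul_assoc, hRR, Matrix.one_mul]
  have hAT : Aᵀ = -A := by
    rw [eq_neg_iff_add_eq_zero, hA]
    ext i j
    have h1 : HasDerivAt (fun s => (fun k => R s k i) ⬝ᵥ (fun k => R s k j))
        ((fun k => R' r k i) ⬝ᵥ (fun k => R r k j) + (fun k => R r k i) ⬝ᵥ (fun k => R' r k j)) r :=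
      aux_dot_deriv (fun s k => R s k i) (fun s k => R s k j) _ _ r
        (hasDerivAt_pi.2 fun k => hR r k i) (hasDerivAt_pi.2 fun k => hR r k j)
    have h2 : (fun s => (fun k => R s k i) ⬝ᵥ (fun k => R s k j))
        = fun _ => (1 : Matrix (Fin 3) (Fin 3) ℝ) i j := by
      funext s
      rw [← hRorth s]; rfl
    rw [h2] at h1
    have h3 := h1.unique (hasDerivAt_const _ _)
    rw [transpose_mul, transpose_transpose]
    exact h3
  have hS : S₁ = WOf (w r) * A * WOf (w r) := by
    simp only [S₁, hinv, hA, Matrix.mul_assoc]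
  have hST : S₁ᵀ = -S₁ := by
    rw [hS, transpose_mul, transpose_mul, aux_WT, hAT]
    simp [Matrix.mul_assoc]
  obtain ⟨m, hm⟩ : ∃ m, m = w r + WOf (w r) *ᵥ θ := ⟨_, rfl⟩
  obtain ⟨u, hu⟩ : ∃ u, u = A *ᵥ m := ⟨_, rfl⟩
  have hWw : WOf (w r) *ᵥ w r = b • w r := by
    have hww : w r ⬝ᵥ w r = b ^ 2 - 1 := by linarith
    have hb1 : b + 1 ≠ 0 := by positivity
    rw [aux_W, hww]
    change _ + ((b + 1)⁻¹ * _) • _ = _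
    ext i
    simp only [Pi.add_apply, Pi.smul_apply, smul_eq_mul]
    field_simp
    ring
  have hSw : b⁻¹ • (S₁ *ᵥ w r) = WOf (w r) *ᵥ (A *ᵥ w r) := by
    rw [hS, ← mulVec_mulVec, ← mulVec_mulVec, hWw, mulVec_smul, mulVec_smul, smul_smul,
      inv_mul_cancel₀ hb.ne', one_smul]
  have hSθ : S₁ *ᵥ θ = WOf (w r) *ᵥ (A *ᵥ (WOf (w r) *ᵥ θ)) := by
    rw [hS, ← mulVec_mulVec, ← mulVec_mulVec]
  have hmu : m ⬝ᵥ u = 0 := by rw [hu]; exact aux_antisymm_quad A hAT m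
  have hθS : θ ⬝ᵥ (S₁ *ᵥ θ) = 0 := aux_antisymm_quad S₁ hST θ
  have hWu : WOf (w r) *ᵥ (A *ᵥ w r) + S₁ *ᵥ θ = WOf (w r) *ᵥ u := by
    rw [hSθ, hu, hm, mulVec_add, mulVec_add]
  have hθWu : θ ⬝ᵥ (WOf (w r) *ᵥ (A *ᵥ w r)) = -(w r ⬝ᵥ u) := by
    have h1 : θ ⬝ᵥ (WOf (w r) *ᵥ (A *ᵥ w r)) = θ ⬝ᵥ (WOf (w r) *ᵥ u) := by
      rw [← hWu, dotProduct_add, hθS, add_zero]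
    rw [hm, add_dotProduct, aux_W, add_dotProduct, smul_dotProduct] at hmu
    rw [h1, aux_W, dotProduct_add, dotProduct_smul, dotProduct_comm θ (w r)]
    simp only [smul_eq_mul] at *
    linear_combination hmu
  obtain ⟨B, hB⟩ : ∃ B, B = (t₁ - (θ ⬝ᵥ t₁) • θ) + crossProduct θ s₁ := ⟨_, rfl⟩
  have hβ : β = r • B := by rw [hB, smul_add]
  have hθB : θ ⬝ᵥ B = 0 := by
    rw [hB, dotProduct_add, dotProduct_sub, dotProduct_smul, hθ, dot_self_cross]
    simp
  have hBe : B = u + ((b + 1)⁻¹ * (w r ⬝ᵥ u)) • w r + (w r ⬝ᵥ u) • θ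
      + (w' r - ((b * (b + 1))⁻¹ * (w r ⬝ᵥ w' r)) • w r)
      - (θ ⬝ᵥ (w' r - ((b * (b + 1))⁻¹ * (w r ⬝ᵥ w' r)) • w r)) • θ
      + (b + 1)⁻¹ • ((θ ⬝ᵥ w r) • w' r - (θ ⬝ᵥ w' r) • w r) := by
    have e1 : t₁ = WOf (w r) *ᵥ (A *ᵥ w r) + WinvOf (w r) *ᵥ w' r := by
      rw [← hSw]
    have e2 : crossProduct θ s₁ = S₁ *ᵥ θ
        + (b + 1)⁻¹ • ((θ ⬝ᵥ w r) • w' r - (θ ⬝ᵥ w' r) • w r) := by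
      rw [← aux_star S₁ hST, ← aux_cross, ← map_smul, ← map_add]
    have e3 := aux_W (w r) u
    rw [← hWu] at e3
    have e4 : WinvOf (w r) *ᵥ w' r = w' r - ((b * (b + 1))⁻¹ * (w r ⬝ᵥ w' r)) • w r :=
      aux_Winv _ _
    rw [hB, e2, e1, dotProduct_add, hθWu, e4, ← e3, add_smul, neg_smul]
    abel
  obtain ⟨z, hz⟩ : ∃ z, z = v + a • B := ⟨_, rfl⟩
  have hθz : θ ⬝ᵥ z = 0 := by rw [hz, dotProduct_add, dotProduct_smul, hv, hθB]; simp
  have hcore := aux_core b a (w r) (w' r) θ v u z hb hb2 hf.ne' (by rw [hz, hBe])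
  have hnorm := aux_norm b (w r) θ z hb hb2 hθ hθz hf.ne' _ rfl
  rw [hcore] at hnorm
  -- derivatives
  have hd1 := aux_fderiv b (w r) θ v (R r) (WOf (w r)) hf.ne'
  have hg : HasDerivAt (fun s => bOf (w s) + θ ⬝ᵥ w s) (w r ⬝ᵥ w' r / b + θ ⬝ᵥ w' r) r := by
    have := (aux_b_deriv w _ r (hw r)).add (aux_dot_deriv _ _ _ _ r (hasDerivAt_const r θ) (hw r))
    exact this.congr_deriv (by simp [b])
  have hd2 := (aux_deriv _ _ _ _ R (R' r) r hg (aux_m_deriv w (w' r) θ r (hw r)) (hR r) hf.ne').deriv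
  obtain ⟨Y, hY⟩ : ∃ Y, Y = (-(v ⬝ᵥ w r + a * (w r ⬝ᵥ w' r / b + θ ⬝ᵥ w' r)) / (b + θ ⬝ᵥ w r)) •
        (w r + (θ + ((b + 1)⁻¹ * (w r ⬝ᵥ θ)) • w r))
      + (v + ((b + 1)⁻¹ * (w r ⬝ᵥ v)) • w r) + a • u
      + a • (w' r + (((b + 1)⁻¹ * (w r ⬝ᵥ θ)) • w' r +
        (-((w r ⬝ᵥ w' r) / b) / (b + 1) ^ 2 * (w r ⬝ᵥ θ)
          + (b + 1)⁻¹ * (w' r ⬝ᵥ θ)) • w r)) := ⟨_, rfl⟩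
  rw [← hY] at hnorm
  have hm2 : m = w r + (θ + ((b + 1)⁻¹ * (w r ⬝ᵥ θ)) • w r) := by rw [hm, aux_W]
  have hX : f • X = R r *ᵥ Y := by
    have e1 : X = (-(v ⬝ᵥ w r) / f ^ 2) • (R r *ᵥ m) + f⁻¹ • (R r *ᵥ (WOf (w r) *ᵥ v))
        + a • deriv (fun s => ζ s θ) r := by
      rw [hm, ← hd1]
    have e3 : WOf (w r) *ᵥ v = v + ((b + 1)⁻¹ * (w r ⬝ᵥ v)) • w r := aux_W _ _
    rw [e1, hd2, ← hm, hR', ← mulVec_mulVec, ← hu, hY, ← hm2, e3]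
    change f • (_ + a • ((_ / f ^ 2) • _ + f⁻¹ • _)) = R r *ᵥ ((_ / f) • _ + _ + _ + _)
    simp only [← mulVec_add, ← mulVec_smul]
    congr 1
    have hf' : f ≠ 0 := hf.ne'
    ext i
    simp only [Pi.add_apply, Pi.smul_apply, smul_eq_mul]
    change _ = _ + a * (_ + (_ * _ + (-(w r ⬝ᵥ w' r / bOf (w r)) / (bOf (w r) + 1) ^ 2 * _ + (bOf (w r) + 1)⁻¹ * _) * _))
    change _ = _ + a * (_ + ((bOf (w r) + 1)⁻¹ * _ * _ + _))
    generalize w' r i + _ = y1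
    field_simp
    ring
  have hXX : f ^ 2 * (X ⬝ᵥ X) = z ⬝ᵥ z := by
    have e1 : (f • X) ⬝ᵥ (f • X) = f ^ 2 * (X ⬝ᵥ X) := by
      simp only [smul_dotProduct, dotProduct_smul, smul_eq_mul]; ring
    rw [← e1, hX, ← hnorm, dotProduct_mulVec, ← mulVec_transpose, mulVec_mulVec, hRorth, one_mulVec]
  have hend : r • v + a • β = r • z := by
    rw [hβ, hz, smul_add, smul_comm]
  rw [hend]
  simp only [smul_dotProduct, dotProduct_smul, smul_eq_mul, ← hXX, ρ]
  ring
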